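/- arXiv:1604.00573 — 2 statements merged into one kernel-verified Lean document; each statement's English description precedes it below -/
import Mathlib

section
/- Under the standing hypotheses, the centralizer A of j is malnormal in G: for every g ∈ G with g ∉ A, the intersection A ∩ g⁻¹·A·g is trivial. -/
/-- An involution: an element of order 2. -/
def IsInvol {G : Type*} [Group G] (s : G) : Prop := orderOf s = 2

/-- `s₁ ∼_j s₂`: there are nonzero integers `m, n` with `(j·s₁)^m = (j·s₂)^n`. -/
def JEquiv {G : Type*} [Group G] (j s₁ s₂ : G) : Prop :=
  ∃ m n : ℤ, m ≠ 0 ∧ n ≠ 0 ∧ (j * s₁) ^ m = (j * s₂) ^ n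

/-- `s₁` is minimal relative to `j`: `⟨j, s₂⟩ ≤ ⟨j, s₁⟩` for every involution `s₂ ∼_j s₁`. -/
def JMinimal {G : Type*} [Group G] (j s₁ : G) : Prop :=
  ∀ s₂ : G, IsInvol s₂ → JEquiv j s₂ s₁ →
    Subgroup.closure ({j, s₂} : Set G) ≤ Subgroup.closure ({j, s₁} : Set G)

/-- The standing hypotheses (1)–(6) on `G`, `j`, `t`, `t'`. -/
structure StandingHyp {G : Type*} [Group G] (j t t' : G) : Prop where
  invol_j : IsInvol j
  invol_t : IsInvol t
  invol_t' : IsInvol t'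
  tconj : t' * j * t' = t
  all_conj : ∀ s₁ s₂ : G, IsInvol s₁ → IsInvol s₂ → IsConj s₁ s₂
  infinite_order : ∀ r s : G, IsInvol r → IsInvol s → r ≠ s → ¬ IsOfFinOrder (r * s)
  unique_root : ∀ n : ℕ, 0 < n → ∃! s : G, IsInvol s ∧ (j * s) ^ n = j * t
  conj_in_A : ∀ s : G, IsInvol s → JEquiv j s t →
      ∃ a ∈ Subgroup.centralizer ({j} : Set G), a⁻¹ * t * a = s
  centralizer_eq : ∀ s : G, IsInvol s → s ≠ j → ∀ x : G,
      x ∈ Subgroup.centralizer ({j * s} : Set G) ↔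
        x = 1 ∨ ∃ s' : G, IsInvol s' ∧ JEquiv j s' s ∧ x = j * s'
  unique_minimal : ∀ s : G, IsInvol s →
      ¬ (∃ a ∈ Subgroup.centralizer ({j} : Set G),
           ∃ b ∈ Subgroup.centralizer ({j} : Set G), s = a * t * b) →
      ∃! s' : G, IsInvol s' ∧ JEquiv j s' s ∧ JMinimal j s'

/-- An involution squares to the identity. -/
theorem IsInvol.mul_self {G : Type*} [Group G] {s : G} (hs : IsInvol s) : s * s = 1 := by
  rw [← pow_two, ← hs, pow_orderOf_eq_one]

/-- A conjugate of an involution is an involution. -/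
theorem IsInvol.conj {G : Type*} [Group G] {s : G} (hs : IsInvol s) (g : G) :
    IsInvol (g⁻¹ * s * g) := by
  have h := (MulAut.conj g⁻¹).orderOf_eq s
  rw [MulAut.conj_apply, inv_inv] at h
  exact h.trans hs

/-- `A = Cen(j)` is malnormal in `G`. -/
theorem centralizer_malnormal {G : Type*} [Group G] (j t t' : G)
    (H : StandingHyp j t t') :
    ∀ g : G, g ∉ Subgroup.centralizer ({j} : Set G) →
      ∀ x : G, x ∈ Subgroup.centralizer ({j} : Set G) →
        g * x * g⁻¹ ∈ Subgroup.centralizer ({j} : Set G) → x = 1 := by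
  intro g hg x hx hgx
  rw [Subgroup.mem_centralizer_singleton_iff] at hg hx hgx
  have hk : g⁻¹ * j * g ≠ j := fun h => hg <| by
    rw [mul_assoc, inv_mul_eq_iff_eq_mul] at h
    exact h.symm
  have hxj : Commute x j := hx
  have hxk : Commute x (g⁻¹ * j * g) := by
    have h : Commute (g * x * g⁻¹) j := hgx
    have h' := h.map (MulAut.conj g⁻¹)
    simpa [MulAut.conj_apply, mul_assoc] using h'
  have hxc : x ∈ Subgroup.centralizer ({j * (g⁻¹ * j * g)} : Set G) :=
    Subgroup.mem_centralizer_singleton_iff.2 (hxj.mul_right hxk)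
  obtain h | ⟨s, hs, -, rfl⟩ := (H.centralizer_eq _ (H.invol_j.conj g) hk x).1 hxc
  · exact h
  have hj := H.invol_j.mul_self
  by_cases hjs : j = s
  · rw [← hjs, hj]
  refine absurd (isOfFinOrder_iff_pow_eq_one.2 ⟨2, two_pos, ?_⟩)
    (H.infinite_order j s H.invol_j hs hjs)
  calc (j * s) ^ 2 = j * s * j * s := by rw [pow_two, mul_assoc (j * s)]
    _ = j * (j * s) * s := by rw [hxj.eq]
    _ = 1 := by rw [← mul_assoc, hj, one_mul, hs.mul_self]
end

section
/- Under the standing hypotheses, for any two distinct involutions s₁, s₂ ∈ G with s₁·s₂ ∈ ⟨j, t⟩, there exists g ∈ G with g⁻¹·s₁·g = j and g⁻¹·s₂·g = t. -/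
theorem isInvol_iff {G : Type*} [Group G] {s : G} : IsInvol s ↔ s * s = 1 ∧ s ≠ 1 := by
  have h := orderOf_eq_prime_iff (x := s) (p := 2)
  rwa [pow_two] at h

theorem semiconjBy_inv_mul_of_mul_self {G : Type*} [Group G] {j t : G} (hj : j * j = 1)
    (ht : t * t = 1) : SemiconjBy j (j * t) (j * t)⁻¹ := by
  rw [SemiconjBy, mul_inv_rev, ← eq_inv_of_mul_eq_one_left hj, ← eq_inv_of_mul_eq_one_left ht,
    ← mul_assoc, hj, one_mul, mul_assoc, hj, mul_one]

/-- Every element of a dihedral group is a rotation or a reflection. -/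
theorem exists_zpow_of_mem_closure_pair {G : Type*} [Group G] {j t x : G} (hj : j * j = 1)
    (ht : t * t = 1) (hx : x ∈ Subgroup.closure ({j, t} : Set G)) :
    ∃ k : ℤ, x = (j * t) ^ k ∨ x = (j * t) ^ k * j := by
  have hcomm (k : ℤ) : j * (j * t) ^ k = (j * t) ^ (-k) * j := by
    have h := ((semiconjBy_inv_mul_of_mul_self hj ht).zpow_right k).eq
    rwa [inv_zpow'] at h
  have hj' : j⁻¹ = j := inv_eq_of_mul_eq_one_left hj
  induction hx using Subgroup.closure_induction with
  | mem x hx =>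
    rcases hx with rfl | rfl
    · exact ⟨0, Or.inr (by simp)⟩
    · refine ⟨-1, Or.inr ?_⟩
      rw [zpow_neg_one, mul_inv_rev, hj', mul_assoc, hj, mul_one]
      exact eq_inv_of_mul_eq_one_left ht
  | one => exact ⟨0, Or.inl (by simp)⟩
  | mul x y _ _ hx hy =>
    obtain ⟨k, rfl | rfl⟩ := hx <;> obtain ⟨l, rfl | rfl⟩ := hy
    · exact ⟨k + l, Or.inl (zpow_add _ _ _).symm⟩
    · exact ⟨k + l, Or.inr (by rw [zpow_add, mul_assoc])⟩
    · exact ⟨k + -l, Or.inr (by rw [mul_assoc, hcomm, zpow_add, mul_assoc])⟩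
    · refine ⟨k + -l, Or.inl ?_⟩
      rw [mul_assoc, ← mul_assoc j, hcomm, mul_assoc _ j j, hj, mul_one, zpow_add]
  | inv x _ hx =>
    obtain ⟨k, rfl | rfl⟩ := hx
    · exact ⟨-k, Or.inl (zpow_neg _ _).symm⟩
    · exact ⟨k, Or.inr (by rw [mul_inv_rev, hj', ← zpow_neg, hcomm, neg_neg])⟩

/-- Two involutions inverting the same element have a product centralizing it. -/
theorem commute_mul_of_semiconjBy_inv {G : Type*} [Group G] {a b x : G}
    (ha : SemiconjBy a x x⁻¹) (hb : SemiconjBy b x x⁻¹) : Commute (a * b) x := by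
  have h := ha.inv_right.mul_left hb
  rwa [inv_inv] at h

/-- An involution `s ≠ j` for which `j * s` commutes with `j * t` is conjugate to `t` under the
centralizer of `j`. -/
theorem StandingHyp.exists_conj_of_commute {G : Type*} [Group G] {j t t' : G}
    (H : StandingHyp j t t') (htj : t ≠ j) {s : G} (hs : s ≠ j)
    (hc : Commute (j * s) (j * t)) : ∃ a : G, a * j = j * a ∧ a⁻¹ * t * a = s := by
  have hmem : j * s ∈ Subgroup.centralizer ({j * t} : Set G) :=
    Subgroup.mem_centralizer_singleton_iff.2 hc.eq
  rcases (H.centralizer_eq t H.invol_t htj _).1 hmem with h | ⟨s', hs', he, h⟩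
  · exact absurd (mul_left_cancel (h.trans (isInvol_iff.1 H.invol_j).1.symm)) hs
  · obtain rfl := mul_left_cancel h
    obtain ⟨a, ha, hat⟩ := H.conj_in_A s hs' he
    exact ⟨a, Subgroup.mem_centralizer_singleton_iff.1 ha, hat⟩

/-- distinct involutions `s₁, s₂` with `s₁·s₂ ∈ ⟨j, t⟩` are simultaneously
conjugate to `j, t`. -/
theorem translations_are_conjugate {G : Type*} [Group G] (j t t' : G)
    (H : StandingHyp j t t') (s₁ s₂ : G)
    (h₁ : IsInvol s₁) (h₂ : IsInvol s₂) (h₁₂ : s₁ ≠ s₂)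
    (hmem : s₁ * s₂ ∈ Subgroup.closure ({j, t} : Set G)) :
    ∃ g : G, g⁻¹ * s₁ * g = j ∧ g⁻¹ * s₂ * g = t := by
  obtain ⟨hjj, -⟩ := isInvol_iff.1 H.invol_j
  obtain ⟨htt, -⟩ := isInvol_iff.1 H.invol_t
  obtain ⟨ht't', -⟩ := isInvol_iff.1 H.invol_t'
  obtain ⟨h₁₁, -⟩ := isInvol_iff.1 h₁
  obtain ⟨h₂₂, -⟩ := isInvol_iff.1 h₂
  have hinf := H.infinite_order s₁ s₂ h₁ h₂ h₁₂
  have hsq : (s₁ * s₂) * (s₁ * s₂) ≠ 1 := fun h =>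
    hinf (isOfFinOrder_iff_pow_eq_one.2 ⟨2, by norm_num, by rw [pow_two, h]⟩)
  have hsemi (k : ℤ) : SemiconjBy j ((j * t) ^ k) ((j * t) ^ k)⁻¹ := by
    have h := (semiconjBy_inv_mul_of_mul_self hjj htt).zpow_right k
    rwa [inv_zpow] at h
  obtain ⟨k, hk | hk⟩ := exists_zpow_of_mem_closure_pair hjj htt hmem
  swap
  · refine absurd ?_ hsq
    rw [hk, mul_assoc, ← mul_assoc j, (hsemi k).eq, mul_assoc _ j j, hjj, mul_one, mul_inv_cancel]
  have hx1 : s₁ * s₂ ≠ 1 := fun h => hsq (by rw [h, one_mul])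
  have hk0 : k ≠ 0 := by
    rintro rfl
    exact hx1 (by rw [hk, zpow_zero])
  have htj : t ≠ j := by
    rintro rfl
    exact hx1 (by rw [hk, hjj, one_zpow])
  have hxr : Commute (s₁ * s₂) (j * t) := hk ▸ Commute.zpow_self (j * t) k
  by_cases hs₁ : s₁ = j
  · subst hs₁
    obtain ⟨a, ha, hat⟩ := H.exists_conj_of_commute htj h₁₂.symm hxr
    refine ⟨a⁻¹, by rw [inv_inv, ha, mul_inv_cancel_right], ?_⟩
    rw [← hat]
    group
  · have hcomm : Commute (j * s₁) (s₁ * s₂) :=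
      commute_mul_of_semiconjBy_inv (hk ▸ hsemi k) (semiconjBy_inv_mul_of_mul_self h₁₁ h₂₂)
    have hs'inv : IsInvol (j * (j * t) ^ k) := by
      refine isInvol_iff.2 ⟨?_, fun h => hsq ?_⟩
      · nth_rw 1 [(hsemi k).eq]
        rw [mul_assoc, ← mul_assoc j, hjj, one_mul, inv_mul_cancel]
      · rw [hk, eq_inv_of_mul_eq_one_right h, ← mul_inv_rev, hjj, inv_one]
    have hmem' : j * s₁ ∈ Subgroup.centralizer ({j * (j * (j * t) ^ k)} : Set G) := by
      rw [Subgroup.mem_centralizer_singleton_iff, ← mul_assoc j j, hjj, one_mul, ← hk]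
      exact hcomm.eq
    have hs'j : j * (j * t) ^ k ≠ j := fun h => hx1 (by rw [hk, mul_eq_left.1 h])
    rcases (H.centralizer_eq _ hs'inv hs'j _).1 hmem' with h | ⟨s', -, ⟨m, n, hm, hn, he⟩, h⟩
    · exact absurd (mul_left_cancel (h.trans hjj.symm)) hs₁
    obtain rfl := mul_left_cancel h
    rw [← mul_assoc j j, hjj, one_mul, ← zpow_mul] at he
    obtain ⟨a, ha, rfl⟩ := H.conj_in_A s₁ h₁ ⟨m, k * n, hm, mul_ne_zero hk0 hn, he⟩
    have haj : a * j * a⁻¹ = j := by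
      rw [Subgroup.mem_centralizer_singleton_iff.1 ha, mul_inv_cancel_right]
    have ht'inv : t'⁻¹ = t' := inv_eq_of_mul_eq_one_left ht't'
    have hconj₁ : MulAut.conj (t' * a) (a⁻¹ * t * a) = j := by
      rw [MulAut.conj_apply, ← H.tconj]
      simp only [mul_inv_rev, ht'inv, mul_assoc, mul_inv_cancel_left, ht't', mul_one]
      rw [← mul_assoc, ht't', one_mul]
    have hconj_j : MulAut.conj (t' * a) j = t := by
      rw [MulAut.conj_apply, mul_inv_rev, ht'inv, ← H.tconj]
      nth_rw 2 [← haj]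
      group
    have hne : MulAut.conj (t' * a) s₂ ≠ j := fun h =>
      h₁₂ ((MulAut.conj (t' * a)).injective (hconj₁.trans h.symm))
    have hcomm' : Commute (j * MulAut.conj (t' * a) s₂) (j * t) := by
      have h := (hcomm.symm.map (MulAut.conj (t' * a))).inv_right
      rwa [map_mul _ _ s₂, map_mul _ j, hconj₁, hconj_j, mul_inv_rev, ← eq_inv_of_mul_eq_one_left hjj,
        ← eq_inv_of_mul_eq_one_left htt] at h
    obtain ⟨b, hb, hbt⟩ := H.exists_conj_of_commute htj hne hcomm'
    refine ⟨(b * (t' * a))⁻¹, ?_, ?_⟩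
    · calc _ = b * MulAut.conj (t' * a) (a⁻¹ * t * a) * b⁻¹ := by
            rw [MulAut.conj_apply]; group
        _ = j := by rw [hconj₁, hb, mul_inv_cancel_right]
    · calc _ = b * MulAut.conj (t' * a) s₂ * b⁻¹ := by
            rw [MulAut.conj_apply]; group
        _ = t := by rw [← hbt]; group
end
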